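/- arXiv:2203.02816 — 2 statements merged into one kernel-verified Lean document; each statement's English description precedes it below -/
import Mathlib

section
/- Let n ≥ 1, let Q₁ and Q₂ be n×n symmetric positive definite real matrices, and let p > 0. Then the Minkowski sum of the ellipsoids {x ∈ ℝⁿ : xᵀ Q₁⁻¹ x ≤ 1} and {x ∈ ℝⁿ : xᵀ Q₂⁻¹ x ≤ 1} is contained in the ellipsoid {x ∈ ℝⁿ : xᵀ ( (1 + 1/p)·Q₁ + (1 + p)·Q₂ )⁻¹ x ≤ 1}. -/
open Matrix Pointwise

/-- The Fenchel–Young inequality for the quadratic form of a positive definite matrix. -/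
theorem Matrix.PosDef.two_mul_dotProduct_le {ι : Type*} [Fintype ι] [DecidableEq ι]
    {Q : Matrix ι ι ℝ} (hQ : Q.PosDef) (x z : ι → ℝ) :
    2 * (x ⬝ᵥ z) ≤ x ⬝ᵥ Q⁻¹ *ᵥ x + z ⬝ᵥ Q *ᵥ z := by
  have hdet : IsUnit Q.det := (isUnit_iff_isUnit_det Q).mp hQ.isUnit
  have hinv : Q⁻¹ *ᵥ (Q *ᵥ z) = z := by
    rw [mulVec_mulVec, nonsing_inv_mul Q hdet, one_mulVec]
  have hsymm : Qᵀ = Q := by simpa using hQ.isHermitian.eq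
  have hcross : (Q *ᵥ z) ⬝ᵥ (Q⁻¹ *ᵥ x) = x ⬝ᵥ z := by
    rw [← vecMul_transpose, hsymm, ← dotProduct_mulVec, mulVec_mulVec,
      mul_nonsing_inv Q hdet, one_mulVec, dotProduct_comm]
  have h := hQ.inv.posSemidef.dotProduct_mulVec_nonneg (x - Q *ᵥ z)
  simp only [star_trivial, mulVec_sub, hinv, sub_dotProduct, dotProduct_sub, hcross] at h
  rw [dotProduct_comm (Q *ᵥ z) z] at h
  linarith

/-- **Minkowski sum of ellipsoids.** For symmetric positive definite `Q₁, Q₂` and any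
`p > 0`, the Minkowski sum of the ellipsoids `{x : xᵀQ₁⁻¹x ≤ 1}` and `{x : xᵀQ₂⁻¹x ≤ 1}`
is contained in the ellipsoid associated with `(1 + 1/p)·Q₁ + (1 + p)·Q₂`. -/
theorem ellipsoid_minkowski_sum_subset
    {n : ℕ} (hn : 1 ≤ n)
    (Q₁ Q₂ : Matrix (Fin n) (Fin n) ℝ) (hQ₁ : Q₁.PosDef) (hQ₂ : Q₂.PosDef)
    (p : ℝ) (hp : 0 < p) :
    {x : Fin n → ℝ | x ⬝ᵥ Q₁⁻¹ *ᵥ x ≤ 1} + {x : Fin n → ℝ | x ⬝ᵥ Q₂⁻¹ *ᵥ x ≤ 1} ⊆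
      {x : Fin n → ℝ | x ⬝ᵥ ((1 + 1/p) • Q₁ + (1 + p) • Q₂)⁻¹ *ᵥ x ≤ 1} := by
  rintro _ ⟨x₁, hx₁, x₂, hx₂, rfl⟩
  simp only [Set.mem_ofPred_eq] at hx₁ hx₂ ⊢
  have ha : 0 < 1 + 1 / p := by positivity
  have hb : 0 < 1 + p := by positivity
  set S := (1 + 1 / p) • Q₁ + (1 + p) • Q₂ with hS
  have hSpos : S.PosDef := (hQ₁.smul ha).add (hQ₂.smul hb)
  have hdet : IsUnit S.det := (isUnit_iff_isUnit_det S).mp hSpos.isUnit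
  set y := S⁻¹ *ᵥ (x₁ + x₂) with hy
  have hSy : S *ᵥ y = x₁ + x₂ := by
    rw [hy, mulVec_mulVec, mul_nonsing_inv S hdet, one_mulVec]
  have hq : (x₁ + x₂) ⬝ᵥ y =
      (1 + 1 / p) * (y ⬝ᵥ Q₁ *ᵥ y) + (1 + p) * (y ⬝ᵥ Q₂ *ᵥ y) := by
    rw [← hSy, dotProduct_comm, hS]
    simp only [add_mulVec, smul_mulVec, dotProduct_add, dotProduct_smul, smul_eq_mul]
  have key {Q : Matrix (Fin n) (Fin n) ℝ} (hQ : Q.PosDef) {x : Fin n → ℝ}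
      (hx : x ⬝ᵥ Q⁻¹ *ᵥ x ≤ 1) {a : ℝ} (ha : 0 < a) :
      2 * (x ⬝ᵥ y) ≤ 1 / a + a * (y ⬝ᵥ Q *ᵥ y) := by
    have h := hQ.two_mul_dotProduct_le x (a • y)
    simp only [mulVec_smul, dotProduct_smul, smul_dotProduct, smul_eq_mul] at h
    have h' : 2 * (x ⬝ᵥ y) * a ≤ 1 + a * (y ⬝ᵥ Q *ᵥ y) * a := by linarith
    calc 2 * (x ⬝ᵥ y) ≤ (1 + a * (y ⬝ᵥ Q *ᵥ y) * a) / a := (le_div_iff₀ ha).mpr h'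
      _ = 1 / a + a * (y ⬝ᵥ Q *ᵥ y) := by field_simp
  have h₁ := key hQ₁ hx₁ ha
  have h₂ := key hQ₂ hx₂ hb
  have hsum : 1 / (1 + 1 / p) + 1 / (1 + p) = 1 := by field_simp; ring
  have hadd : (x₁ + x₂) ⬝ᵥ y = x₁ ⬝ᵥ y + x₂ ⬝ᵥ y := add_dotProduct _ _ _
  linarith
end

section
/- Let n ≥ 1, let Q be an n×n symmetric positive definite real matrix, let r > 0, let μ ∈ ℝⁿ, and let l₀ ∈ ℝⁿ be a unit vector. Set s = √(l₀ᵀ Q l₀) and Q⁺ = (s + r)·( Q/s + r·I_n ). Then Q⁺ is symmetric positive definite, and the Minkowski sum of the ellipsoid {x ∈ ℝⁿ : (x − μ)ᵀ Q⁻¹ (x − μ) ≤ 1} with the closed ball Ball(0, r) is contained in the ellipsoid {x ∈ ℝⁿ : (x − μ)ᵀ (Q⁺)⁻¹ (x − μ) ≤ 1}. -/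
open Matrix Pointwise Real

namespace Matrix.PosDef

variable {ι : Type*} [Fintype ι] [DecidableEq ι] {A B : Matrix ι ι ℝ}

/-- The Fenchel–Young inequality for the quadratic form of a positive definite matrix. -/
theorem two_mul_dotProduct_sub_le (hA : A.PosDef) (w x : ι → ℝ) :
    2 * (w ⬝ᵥ x) - w ⬝ᵥ A *ᵥ w ≤ x ⬝ᵥ A⁻¹ *ᵥ x := by
  have hu : IsUnit A.det := (isUnit_iff_isUnit_det A).1 hA.isUnit
  have hT : Aᵀ = A := by simpa using hA.isHermitian.eq
  have h0 : 0 ≤ (w - A⁻¹ *ᵥ x) ⬝ᵥ A *ᵥ (w - A⁻¹ *ᵥ x) := by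
    simpa using hA.posSemidef.dotProduct_mulVec_nonneg (w - A⁻¹ *ᵥ x)
  have h1 : A *ᵥ (A⁻¹ *ᵥ x) = x := by
    rw [mulVec_mulVec, mul_nonsing_inv A hu, one_mulVec]
  have h2 : (A⁻¹ *ᵥ x) ⬝ᵥ A *ᵥ w = w ⬝ᵥ x := by
    rw [dotProduct_mulVec, ← mulVec_transpose, hT, h1, dotProduct_comm]
  rw [mulVec_sub, h1, sub_dotProduct, dotProduct_sub, dotProduct_sub, h2,
    dotProduct_comm (A⁻¹ *ᵥ x) x] at h0
  linarith

/-- The map `(x, A) ↦ xᵀ A⁻¹ x` is subadditive on positive definite matrices. -/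
theorem add_dotProduct_inv_mulVec_add_le (hA : A.PosDef) (hB : B.PosDef) (x y : ι → ℝ) :
    (x + y) ⬝ᵥ (A + B)⁻¹ *ᵥ (x + y) ≤ x ⬝ᵥ A⁻¹ *ᵥ x + y ⬝ᵥ B⁻¹ *ᵥ y := by
  have hu : IsUnit (A + B).det := (isUnit_iff_isUnit_det _).1 (hA.add hB).isUnit
  set w := (A + B)⁻¹ *ᵥ (x + y) with hw
  have h1 : A *ᵥ w + B *ᵥ w = x + y := by
    rw [← add_mulVec, hw, mulVec_mulVec, mul_nonsing_inv _ hu, one_mulVec]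
  have h2 : w ⬝ᵥ A *ᵥ w + w ⬝ᵥ B *ᵥ w = w ⬝ᵥ x + w ⬝ᵥ y := by
    rw [← dotProduct_add, h1, dotProduct_add]
  have hx := hA.two_mul_dotProduct_sub_le w x
  have hy := hB.two_mul_dotProduct_sub_le w y
  rw [dotProduct_comm, dotProduct_add]
  linarith

end Matrix.PosDef

theorem Matrix.dotProduct_inv_smul_mulVec {ι : Type*} [Fintype ι] [DecidableEq ι]
    {A : Matrix ι ι ℝ} (hA : A.PosDef) {c : ℝ} (hc : c ≠ 0) (x : ι → ℝ) :
    x ⬝ᵥ (c • A)⁻¹ *ᵥ x = c⁻¹ * (x ⬝ᵥ A⁻¹ *ᵥ x) := by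
  have hu : IsUnit A.det := (isUnit_iff_isUnit_det A).1 hA.isUnit
  have h : (c • A)⁻¹ = c⁻¹ • A⁻¹ := by
    apply inv_eq_right_inv
    rw [smul_mul_smul_comm, mul_inv_cancel₀ hc, mul_nonsing_inv A hu, one_smul]
  rw [h, smul_mulVec, dotProduct_smul, smul_eq_mul]

/-- **Ellipsoid inflation formula (definition of `Q⁺` in Proposition 1).** With
`s = √(l₀ᵀ Q l₀)` for a unit vector `l₀` and `Q⁺ = (s + r)·(Q/s + r·I)`, the matrix `Q⁺`
is symmetric positive definite and the Minkowski sum of the ellipsoid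
`{x : (x−μ)ᵀQ⁻¹(x−μ) ≤ 1}` with `Ball(0, r)` is contained in
`{x : (x−μ)ᵀ(Q⁺)⁻¹(x−μ) ≤ 1}`. -/
theorem ellipsoid_ball_inflation
    {n : ℕ} (hn : 1 ≤ n)
    (Q : Matrix (Fin n) (Fin n) ℝ) (hQ : Q.PosDef)
    (r : ℝ) (hr : 0 < r)
    (μ l₀ : EuclideanSpace ℝ (Fin n)) (hl₀ : ‖l₀‖ = 1)
    (s : ℝ) (hs : s = Real.sqrt (l₀ ⬝ᵥ Q *ᵥ l₀))
    (Qp : Matrix (Fin n) (Fin n) ℝ)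
    (hQp : Qp = (s + r) • (s⁻¹ • Q + r • (1 : Matrix (Fin n) (Fin n) ℝ))) :
    Qp.PosDef ∧
      {x : EuclideanSpace ℝ (Fin n) | (x - μ) ⬝ᵥ Q⁻¹ *ᵥ (x - μ) ≤ 1} +
          Metric.closedBall (0 : EuclideanSpace ℝ (Fin n)) r ⊆
        {x : EuclideanSpace ℝ (Fin n) | (x - μ) ⬝ᵥ Qp⁻¹ *ᵥ (x - μ) ≤ 1} := by
  have hl : (l₀ : Fin n → ℝ) ≠ 0 := by
    intro h
    have h0 : l₀ = 0 := by ext i; exact congrFun h i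
    simp [h0] at hl₀
  have hspos : 0 < s := by
    rw [hs]
    apply Real.sqrt_pos.2
    simpa using hQ.dotProduct_mulVec_pos hl
  have ha : 0 < (s + r) * s⁻¹ := by positivity
  have hb : 0 < (s + r) * r := by positivity
  have hA : (((s + r) * s⁻¹) • Q).PosDef := hQ.smul ha
  have h1 : (1 : Matrix (Fin n) (Fin n) ℝ).PosDef := PosDef.one
  have hB : (((s + r) * r) • (1 : Matrix (Fin n) (Fin n) ℝ)).PosDef := h1.smul hb
  have hQp' : Qp = ((s + r) * s⁻¹) • Q + ((s + r) * r) • (1 : Matrix (Fin n) (Fin n) ℝ) := by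
    rw [hQp, smul_add, smul_smul, smul_smul]
  refine ⟨hQp' ▸ hA.add hB, ?_⟩
  rintro _ ⟨x, hx, y, hy, rfl⟩
  simp only [Set.mem_ofPred_eq, mem_closedBall_zero_iff] at hx hy ⊢
  have hyy : (y : Fin n → ℝ) ⬝ᵥ y ≤ r ^ 2 := by
    have h : (y : Fin n → ℝ) ⬝ᵥ y = ‖y‖ ^ 2 := by
      rw [EuclideanSpace.real_norm_sq_eq]
      simp only [dotProduct, sq]
    rw [h]
    gcongr
  have key := hA.add_dotProduct_inv_mulVec_add_le hB (x - μ) y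
  rw [← hQp', dotProduct_inv_smul_mulVec hQ ha.ne', dotProduct_inv_smul_mulVec h1 hb.ne',
    inv_one, one_mulVec] at key
  have hsum : (x + y - μ : EuclideanSpace ℝ (Fin n)).ofLp = x.ofLp - μ.ofLp + y.ofLp := by
    simp only [WithLp.ofLp_sub, WithLp.ofLp_add]
    abel
  change (x + y - μ).ofLp ⬝ᵥ Qp⁻¹ *ᵥ (x + y - μ).ofLp ≤ 1
  rw [hsum]
  calc _ ≤ _ := key
    _ ≤ ((s + r) * s⁻¹)⁻¹ * 1 + ((s + r) * r)⁻¹ * r ^ 2 := by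
      gcongr
      exact hx
    _ = 1 := by field_simp
end
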